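/- (Split theorem.) Let X : ℝ⁴ → (Fin 4 → Fin 4 → ℝ) be a smooth field of antisymmetric matrices with α-current Z^a = ∂_b X^{ab} and β-current Y^a = ∂_b (*X)^{ab}. Then there exist two smooth fields of antisymmetric matrices X_α and X_β, both closed (∂_{[a} (X_α)_{bc]} = 0 and ∂_{[a} (X_β)_{bc]} = 0 everywhere), such that X = X_α − *(X_β) pointwise, ∂_b (X_α)^{ab} = Z^a, and ∂_b (X_β)^{ab} = Y^a everywhere. -/

import Mathlib

noncomputable section

/-- The Minkowski metric diag(-1,1,1,1); it equals its own inverse. -/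
def mink : Fin 4 → Fin 4 → ℝ :=
  fun a b => if a = b then (if a = 0 then -1 else 1) else 0

/-- The Levi-Civita symbol, totally antisymmetric with `lev 0 1 2 3 = 1`. -/
def lev (a b c d : Fin 4) : ℝ :=
  (((b : ℕ) : ℝ) - ((a : ℕ) : ℝ)) * (((c : ℕ) : ℝ) - ((a : ℕ) : ℝ)) *
      (((d : ℕ) : ℝ) - ((a : ℕ) : ℝ)) * (((c : ℕ) : ℝ) - ((b : ℕ) : ℝ)) *
      (((d : ℕ) : ℝ) - ((b : ℕ) : ℝ)) * (((d : ℕ) : ℝ) - ((c : ℕ) : ℝ)) / 12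

/-- Raise one index with the metric: `A^a = η^{ab} A_b`. -/
def raise1 (A : Fin 4 → ℝ) : Fin 4 → ℝ :=
  fun a => ∑ b, mink a b * A b

/-- Raise both indices of a second rank tensor: `X^{ab} = η^{ac} η^{bd} X_{cd}`. -/
def raise2 (X : Fin 4 → Fin 4 → ℝ) : Fin 4 → Fin 4 → ℝ :=
  fun a b => ∑ c, ∑ d, mink a c * mink b d * X c d

/-- The Hodge dual of a second rank tensor: `(*X)_{ab} = (1/2) ε_{abcd} X^{cd}`. -/
def hodge (X : Fin 4 → Fin 4 → ℝ) : Fin 4 → Fin 4 → ℝ :=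
  fun a b => (1 / 2) * ∑ c, ∑ d, lev a b c d * raise2 X c d

/-- The partial derivative of a function on ℝ⁴ in the `a`-th coordinate direction. -/
def pd (a : Fin 4) (f : (Fin 4 → ℝ) → ℝ) (x : Fin 4 → ℝ) : ℝ :=
  fderiv ℝ f x (Pi.single a 1)

/-- The α-current of a field of antisymmetric matrices: `Z^a = ∂_b X^{ab}`. -/
def alphaCurrent (X : (Fin 4 → ℝ) → Fin 4 → Fin 4 → ℝ) (a : Fin 4) (x : Fin 4 → ℝ) : ℝ :=
  ∑ b, pd b (fun y => raise2 (X y) a b) x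

/-- The β-current of a field of antisymmetric matrices: `Y^a = ∂_b (*X)^{ab}`. -/
def betaCurrent (X : (Fin 4 → ℝ) → Fin 4 → Fin 4 → ℝ) (a : Fin 4) (x : Fin 4 → ℝ) : ℝ :=
  ∑ b, pd b (fun y => raise2 (hodge (X y)) a b) x


open MeasureTheory Topology

set_option linter.unusedSectionVars false

/-- Basic abbreviation for spacetime. -/
abbrev Spt := Fin 4 → ℝ

/-- Coordinate vectors. -/
def ev (i : Fin 4) : Spt := Pi.single i 1

lemma smooth_fderiv_apply {E : Type} [NormedAddCommGroup E] [NormedSpace ℝ E]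
    {f : E → ℝ} (hf : ContDiff ℝ (⊤ : ℕ∞) f) (v : E) :
    ContDiff ℝ (⊤ : ℕ∞) (fun x => fderiv ℝ f x v) :=
  (hf.fderiv_right (m := (⊤ : ℕ∞)) (by simp)).clm_apply contDiff_const

lemma smooth_diff {E : Type} [NormedAddCommGroup E] [NormedSpace ℝ E]
    {f : E → ℝ} (hf : ContDiff ℝ (⊤ : ℕ∞) f) : Differentiable ℝ f :=
  hf.differentiable (by simp)

section param
variable {E P : Type} [NormedAddCommGroup E] [NormedSpace ℝ E] [FiniteDimensional ℝ E]
  [NormedAddCommGroup P] [NormedSpace ℝ P] [FiniteDimensional ℝ P]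
  [MeasurableSpace P] [BorelSpace P]

lemma param_partial {f : E → P → ℝ} (hf : ContDiff ℝ (⊤ : ℕ∞) (Function.uncurry f))
    (x : E) (p : P) : HasFDerivAt (fun y => f y p)
      ((fderiv ℝ (Function.uncurry f) (x, p)).comp (ContinuousLinearMap.inl ℝ E P)) x := by
  have h1 : HasFDerivAt (Function.uncurry f) (fderiv ℝ (Function.uncurry f) (x, p)) (x, p) :=
    (smooth_diff hf _).hasFDerivAt
  have h2 : HasFDerivAt (fun y : E => (y, p)) (ContinuousLinearMap.inl ℝ E P) x :=
    hasFDerivAt_prodMk_left x p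
  exact h1.comp x h2

lemma param_integrable {f : P → ℝ} (hf : Continuous f) (μ : Measure P) [IsFiniteMeasure μ]
    {K : Set P} (hK : IsCompact K) (hμ : μ.restrict K = μ) : Integrable f μ := by
  rw [← hμ]
  exact hf.continuousOn.integrableOn_compact hK

lemma param_hasFDerivAt {f : E → P → ℝ} (hf : ContDiff ℝ (⊤ : ℕ∞) (Function.uncurry f))
    (μ : Measure P) [IsFiniteMeasure μ] {K : Set P} (hK : IsCompact K) (hμ : μ.restrict K = μ)
    (x : E) : HasFDerivAt (fun y => ∫ p, f y p ∂μ)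
      (∫ p, (fderiv ℝ (Function.uncurry f) (x, p)).comp (ContinuousLinearMap.inl ℝ E P) ∂μ) x := by
  have hcd : Continuous (fun q : E × P =>
      (fderiv ℝ (Function.uncurry f) q).comp (ContinuousLinearMap.inl ℝ E P)) :=
    (hf.continuous_fderiv (by simp)).clm_comp continuous_const
  obtain ⟨M, hM⟩ := ((isCompact_closedBall x 1).prod hK).bddAbove_image hcd.norm.continuousOn
  have hcf : ∀ y, Continuous (f y) := fun y => hf.continuous.comp (Continuous.prodMk_right y)
  refine hasFDerivAt_integral_of_dominated_of_fderiv_le (bound := fun _ => M)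
    (Metric.closedBall_mem_nhds x one_pos) ?_ ?_ ?_ ?_ ?_ ?_ (F' := fun x p =>
      (fderiv ℝ (Function.uncurry f) (x, p)).comp (ContinuousLinearMap.inl ℝ E P))
  · exact Filter.Eventually.of_forall fun y => (hcf y).aestronglyMeasurable
  · exact param_integrable (hcf x) μ hK hμ
  · exact (hcd.comp (Continuous.prodMk_right x)).aestronglyMeasurable
  · rw [← hμ]
    refine (ae_restrict_mem hK.measurableSet).mono fun p hp y hy => ?_
    exact hM ⟨(y, p), ⟨hy, hp⟩, rfl⟩
  · exact integrable_const _
  · exact Filter.Eventually.of_forall fun p y _ => param_partial hf y p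

lemma param_fderiv {f : E → P → ℝ} (hf : ContDiff ℝ (⊤ : ℕ∞) (Function.uncurry f))
    (μ : Measure P) [IsFiniteMeasure μ] {K : Set P} (hK : IsCompact K) (hμ : μ.restrict K = μ)
    (x v : E) : fderiv ℝ (fun y => ∫ p, f y p ∂μ) x v
      = ∫ p, fderiv ℝ (fun y => f y p) x v ∂μ := by
  have hcd : Continuous (fun q : E × P =>
      (fderiv ℝ (Function.uncurry f) q).comp (ContinuousLinearMap.inl ℝ E P)) :=
    (hf.continuous_fderiv (by simp)).clm_comp continuous_const
  rw [(param_hasFDerivAt hf μ hK hμ x).fderiv, ContinuousLinearMap.integral_apply]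
  · congr 1; ext p
    rw [(param_partial hf x p).fderiv]
  · rw [← hμ]
    exact (hcd.comp (Continuous.prodMk_right x)).continuousOn.integrableOn_compact hK

lemma param_partial_smooth {f : E → P → ℝ} (hf : ContDiff ℝ (⊤ : ℕ∞) (Function.uncurry f))
    (v : E) : ContDiff ℝ (⊤ : ℕ∞)
      (Function.uncurry fun x p => fderiv ℝ (fun y => f y p) x v) := by
  have : (Function.uncurry fun x p => fderiv ℝ (fun y => f y p) x v)
      = fun q : E × P => fderiv ℝ (Function.uncurry f) q (v, 0) := by
    ext ⟨x, p⟩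
    simp [(param_partial hf x p).fderiv]
  rw [this]
  exact smooth_fderiv_apply hf _

lemma param_smooth {f : E → P → ℝ} (hf : ContDiff ℝ (⊤ : ℕ∞) (Function.uncurry f))
    (μ : Measure P) [IsFiniteMeasure μ] {K : Set P} (hK : IsCompact K) (hμ : μ.restrict K = μ) :
    ContDiff ℝ (⊤ : ℕ∞) (fun y => ∫ p, f y p ∂μ) := by
  rw [contDiff_infty]
  intro n
  induction n generalizing f with
  | zero =>
    have : Differentiable ℝ (fun y => ∫ p, f y p ∂μ) :=
      fun x => (param_hasFDerivAt hf μ hK hμ x).differentiableAt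
    simpa using this.continuous
  | succ n ih =>
    push_cast
    rw [contDiff_succ_iff_fderiv_apply]
    refine ⟨fun x => (param_hasFDerivAt hf μ hK hμ x).differentiableAt, by simp, fun v => ?_⟩
    have := ih (param_partial_smooth hf v)
    convert this using 2 with x
    exact param_fderiv hf μ hK hμ x v
end param

/-- Rotation by the angle `θ` in the coordinate plane `(i, j)`. -/
def rot (i j : Fin 4) (θ : ℝ) (ω : Spt) : Spt :=
  ω + (Real.cos θ - 1) • (ω i • ev i + ω j • ev j) + Real.sin θ • (ω i • ev j - ω j • ev i)

/-- The rotation as a linear map. -/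
def rotL (i j : Fin 4) (θ : ℝ) : Spt →ₗ[ℝ] Spt where
  toFun := rot i j θ
  map_add' x y := by ext k; simp [rot]; ring
  map_smul' c x := by ext k; simp [rot]; ring

/-- The three spatial planes. -/
def IsPlane (i j : Fin 4) : Prop := (i = 1 ∧ j = 2) ∨ (i = 1 ∧ j = 3) ∨ (i = 2 ∧ j = 3)

/-- Squared spatial radius. -/
def rad2 (y : Spt) : ℝ := y 1 ^ 2 + y 2 ^ 2 + y 3 ^ 2

lemma rot_matrix (i j : Fin 4) (θ : ℝ) : LinearMap.toMatrix' (rotL i j θ) =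
    Matrix.of fun a b => (if a = b then 1 else 0) + (Real.cos θ - 1) *
      ((if i = b then 1 else 0) * (if a = i then 1 else 0)
        + (if j = b then 1 else 0) * (if a = j then 1 else 0)) + Real.sin θ *
      ((if i = b then 1 else 0) * (if a = j then 1 else 0)
        - (if j = b then 1 else 0) * (if a = i then 1 else 0)) := by
  ext a b
  simp only [LinearMap.toMatrix'_apply, Matrix.of_apply, rotL, rot, ev, LinearMap.coe_mk,
    AddHom.coe_mk, Pi.add_apply, Pi.sub_apply, Pi.smul_apply, smul_eq_mul, Pi.single_apply]

lemma rot_det {i j : Fin 4} (h : IsPlane i j) (θ : ℝ) : LinearMap.det (rotL i j θ) = 1 := by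
  have hs := Real.sin_sq_add_cos_sq θ
  rw [← LinearMap.det_toMatrix', rot_matrix]
  rcases h with ⟨rfl, rfl⟩ | ⟨rfl, rfl⟩ | ⟨rfl, rfl⟩ <;>
  · simp [Matrix.det_succ_row_zero, Fin.sum_univ_succ, Fin.succAbove]
    linear_combination hs

lemma rot_rad2 {i j : Fin 4} (h : IsPlane i j) (θ : ℝ) (y : Spt) :
    rad2 (rot i j θ y) = rad2 y := by
  have hs := Real.sin_sq_add_cos_sq θ
  rcases h with ⟨rfl, rfl⟩ | ⟨rfl, rfl⟩ | ⟨rfl, rfl⟩ <;>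
  simp [rad2, rot, ev]
  · linear_combination (y 1 ^ 2 + y 2 ^ 2) * hs
  · linear_combination (y 1 ^ 2 + y 3 ^ 2) * hs
  · linear_combination (y 2 ^ 2 + y 3 ^ 2) * hs

lemma rot_zero_coord {i j : Fin 4} (h : IsPlane i j) (θ : ℝ) (y : Spt) :
    rot i j θ y 0 = y 0 := by
  rcases h with ⟨rfl, rfl⟩ | ⟨rfl, rfl⟩ | ⟨rfl, rfl⟩ <;>
  simp [rot, ev]

lemma rot_continuous (i j : Fin 4) (θ : ℝ) : Continuous (rot i j θ) := by
  unfold rot; fun_prop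

/-- A thick cylindrical shell. -/
def shell : Set Spt := {y | |y 0| ≤ 1 ∧ 1 ≤ rad2 y ∧ rad2 y ≤ 4}

/-- Projection of the shell onto the spatial unit sphere. -/
def sph (y : Spt) : Spt := fun k => if k = 0 then 0 else y k / Real.sqrt (rad2 y)

lemma rad2_continuous : Continuous rad2 := by unfold rad2; fun_prop

lemma sph_measurable : Measurable sph := by
  refine measurable_pi_lambda _ fun k => ?_
  by_cases hk : k = 0
  · simp [sph, hk]
  · simp only [sph, hk, if_false]
    exact (measurable_pi_apply k).div rad2_continuous.measurable.sqrt

lemma sph_rot {i j : Fin 4} (h : IsPlane i j) (θ : ℝ) (y : Spt) :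
    sph (rot i j θ y) = rot i j θ (sph y) := by
  have hr := rot_rad2 h θ y
  ext k
  unfold sph
  rw [hr]
  rcases h with ⟨rfl, rfl⟩ | ⟨rfl, rfl⟩ | ⟨rfl, rfl⟩ <;>
  fin_cases k <;> simp [rot, ev] <;> ring

lemma shell_measurable : MeasurableSet shell := by
  have : IsClosed shell := by
    refine IsClosed.inter (isClosed_le (continuous_apply 0).abs continuous_const) (IsClosed.inter ?_ ?_)
    · exact isClosed_le continuous_const rad2_continuous
    · exact isClosed_le rad2_continuous continuous_const
  exact this.measurableSet

lemma shell_lt_top : volume shell < ⊤ := by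
  refine lt_of_le_of_lt (measure_mono (t := Metric.closedBall 0 2) ?_)
    (isCompact_closedBall _ _).measure_lt_top
  rintro y ⟨h0, h1, h2⟩
  rw [mem_closedBall_zero_iff, pi_norm_le_iff_of_nonneg (by norm_num)]
  unfold rad2 at h2
  have hc : ∀ t : ℝ, t ^ 2 ≤ 4 → ‖t‖ ≤ 2 := fun t ht =>
    abs_le_of_sq_le_sq (by linarith) (by norm_num)
  rw [Fin.forall_fin_succ]
  refine ⟨le_trans h0 (by norm_num), ?_⟩
  intro k
  apply hc
  fin_cases k <;> simp <;> nlinarith [sq_nonneg (y 1), sq_nonneg (y 2), sq_nonneg (y 3)]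

lemma shell_pos : volume shell ≠ 0 := by
  have ho : IsOpen {y : Spt | |y 0| < 1 ∧ 1 < rad2 y ∧ rad2 y < 4} := by
    refine IsOpen.inter (isOpen_lt (continuous_apply 0).abs continuous_const) (IsOpen.inter ?_ ?_)
    · exact isOpen_lt continuous_const rad2_continuous
    · exact isOpen_lt rad2_continuous continuous_const
  have hp := ho.measure_pos volume ⟨ev 1 + ev 2, by simp [rad2, ev]; norm_num⟩
  refine (lt_of_lt_of_le hp (measure_mono ?_)).ne'
  rintro y ⟨h0, h1, h2⟩
  exact ⟨h0.le, h1.le, h2.le⟩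

lemma exists_sphere_measure : ∃ μ : Measure Spt, IsProbabilityMeasure μ ∧
    μ.restrict (Metric.closedBall 0 1) = μ ∧
    (∀ᵐ ω ∂μ, ω 0 = 0 ∧ rad2 ω = 1) ∧
    ∀ i j, IsPlane i j → ∀ θ, μ.map (rot i j θ) = μ := by
  set ν : Measure Spt := (volume shell)⁻¹ • volume.restrict shell with hν
  have hprob : IsProbabilityMeasure ν := by
    constructor
    simp [hν, ENNReal.inv_mul_cancel shell_pos shell_lt_top.ne]
  have hae : ∀ᵐ ω ∂(ν.map sph), ω 0 = 0 ∧ rad2 ω = 1 := by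
    rw [ae_map_iff sph_measurable.aemeasurable]
    · refine Measure.ae_smul_measure ?_ _
      refine (ae_restrict_mem shell_measurable).mono fun y hy => ?_
      have h1 : 0 < rad2 y := lt_of_lt_of_le one_pos hy.2.1
      have h2 := Real.sq_sqrt h1.le
      refine ⟨by simp [sph], ?_⟩
      have h3 : rad2 (sph y) = rad2 y / (Real.sqrt (rad2 y)) ^ 2 := by
        have e1 : sph y 1 = y 1 / Real.sqrt (rad2 y) := by simp [sph]
        have e2 : sph y 2 = y 2 / Real.sqrt (rad2 y) := by simp [sph]
        have e3 : sph y 3 = y 3 / Real.sqrt (rad2 y) := by simp [sph]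
        unfold rad2 at e1 e2 e3 ⊢
        rw [e1, e2, e3]
        ring
      rw [h3, h2]
      exact div_self h1.ne'
    · exact ((isClosed_eq (by fun_prop) continuous_const).inter
        (isClosed_eq rad2_continuous continuous_const)).measurableSet
  refine ⟨ν.map sph, Measure.isProbabilityMeasure_map sph_measurable.aemeasurable, ?_, hae, ?_⟩
  · rw [Measure.restrict_eq_self_of_ae_mem]
    refine hae.mono fun ω hω => ?_
    rw [mem_closedBall_zero_iff, pi_norm_le_iff_of_nonneg (by norm_num)]
    obtain ⟨h0, h1⟩ := hω
    unfold rad2 at h1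
    have hc : ∀ t : ℝ, t ^ 2 ≤ 1 → ‖t‖ ≤ 1 := fun t ht =>
      abs_le_of_sq_le_sq (by linarith) (by norm_num)
    rw [Fin.forall_fin_succ]
    refine ⟨by simp [h0], ?_⟩
    intro k
    apply hc
    fin_cases k <;> simp [-sq_le_one_iff_abs_le_one] <;> nlinarith [sq_nonneg (ω 1), sq_nonneg (ω 2), sq_nonneg (ω 3)]
  · intro i j h θ
    have hm := (rot_continuous i j θ).measurable
    rw [Measure.map_map hm sph_measurable]
    have : rot i j θ ∘ sph = sph ∘ rot i j θ := by
      funext y; exact (sph_rot h θ y).symm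
    rw [this, ← Measure.map_map sph_measurable hm]
    congr 1
    rw [hν, Measure.map_smul]
    congr 1
    have hv : MeasurePreserving (rot i j θ) (volume : Measure Spt) volume := by
      refine ⟨hm, ?_⟩
      have := Real.map_linearMap_volume_pi_eq_smul_volume_pi (f := rotL i j θ)
        (by rw [rot_det h]; norm_num)
      rw [rot_det h] at this
      rw [inv_one, abs_one, ENNReal.ofReal_one, one_smul] at this
      exact this
    have hs : rot i j θ ⁻¹' shell = shell := by
      ext y
      simp only [shell, Set.mem_preimage, Set.mem_ofPred_eq, rot_zero_coord h, rot_rad2 h]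
    have := (hv.restrict_preimage shell_measurable).map_eq
    rwa [hs] at this

lemma rot_integral {μ : Measure Spt} [IsProbabilityMeasure μ]
    (hK : μ.restrict (Metric.closedBall 0 1) = μ) {i j : Fin 4}
    (hinv : ∀ θ, μ.map (rot i j θ) = μ) {h : Spt → ℝ} (hh : ContDiff ℝ (⊤ : ℕ∞) h) :
    ∫ ω, fderiv ℝ h ω (ω i • ev j - ω j • ev i) ∂μ = 0 := by
  have hrot : ContDiff ℝ (⊤ : ℕ∞) (Function.uncurry (rot i j)) := by
    unfold rot Function.uncurry
    have h1 : ∀ k, ContDiff ℝ (⊤ : ℕ∞) (fun p : ℝ × Spt => p.2 k) := fun k => by fun_prop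
    fun_prop
  have hs : ContDiff ℝ (⊤ : ℕ∞) (Function.uncurry fun θ ω => h (rot i j θ ω)) :=
    hh.comp hrot
  have key := param_fderiv hs μ (isCompact_closedBall _ _) hK 0 1
  have hc : (fun θ => ∫ ω, h (rot i j θ ω) ∂μ) = fun _ => ∫ ω, h ω ∂μ := by
    funext θ
    conv_rhs => rw [← hinv θ]
    rw [integral_map (rot_continuous i j θ).measurable.aemeasurable
      hh.continuous.aestronglyMeasurable]
  rw [hc] at key
  simp only [fderiv_fun_const, Pi.zero_apply, zero_apply] at key
  rw [key]
  congr 1; ext ω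
  have hd : HasDerivAt (fun θ => rot i j θ ω) (ω i • ev j - ω j • ev i) 0 := by
    unfold rot
    have h1 := ((Real.hasDerivAt_cos 0).sub_const 1).smul_const (ω i • ev i + ω j • ev j)
    have h2 := (Real.hasDerivAt_sin 0).smul_const (ω i • ev j - ω j • ev i)
    have := (h1.const_add ω).add h2
    rw [Real.sin_zero, Real.cos_zero, neg_zero, zero_smul, zero_add, one_smul] at this
    exact this
  have h0 : rot i j 0 ω = ω := by simp [rot]
  have := (h0.symm ▸ (smooth_diff hh ω).hasFDerivAt :
    HasFDerivAt h (fderiv ℝ h ω) (rot i j 0 ω)).comp_hasDerivAt 0 hd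
  rw [fderiv_eq_smul_deriv]
  have h3 := this.deriv
  simp only [Function.comp_def] at h3
  simp [h3]

/-! ### The retarded integral -/

/-- The line integral along the time axis. -/
def retInt (H : ℝ × Spt → ℝ) (x : Spt) : ℝ :=
  ∫ s in Set.Icc (0 : ℝ) 1, x 0 * H (x 0 * s, x - (s * x 0) • ev 0)

lemma retInt_arg_smooth {H : ℝ × Spt → ℝ} (hH : ContDiff ℝ (⊤ : ℕ∞) H) :
    ContDiff ℝ (⊤ : ℕ∞) (Function.uncurry fun (x : Spt) (s : ℝ) =>
      x 0 * H (x 0 * s, x - (s * x 0) • ev 0)) := by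
  have h1 : ContDiff ℝ (⊤ : ℕ∞) (fun p : Spt × ℝ => p.1 0) := by fun_prop
  have h2 : ContDiff ℝ (⊤ : ℕ∞) (fun p : Spt × ℝ =>
      ((p.1 0 * p.2, p.1 - (p.2 * p.1 0) • ev 0) : ℝ × Spt)) := by fun_prop
  exact h1.mul (hH.comp h2)

lemma retInt_smooth {H : ℝ × Spt → ℝ} (hH : ContDiff ℝ (⊤ : ℕ∞) H) :
    ContDiff ℝ (⊤ : ℕ∞) (retInt H) :=
  param_smooth (retInt_arg_smooth hH) (volume.restrict (Set.Icc (0 : ℝ) 1))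
    (K := Set.Icc 0 1) isCompact_Icc (by rw [Measure.restrict_restrict measurableSet_Icc]; simp)

lemma retInt_deriv {H : ℝ × Spt → ℝ} (hH : ContDiff ℝ (⊤ : ℕ∞) H) (x v : Spt) :
    fderiv ℝ (retInt H) x v = ∫ s in Set.Icc (0 : ℝ) 1,
      (v 0 * H (x 0 * s, x - (s * x 0) • ev 0) + x 0 *
        fderiv ℝ H (x 0 * s, x - (s * x 0) • ev 0) (v 0 * s, v - (s * v 0) • ev 0)) := by
  unfold retInt
  rw [param_fderiv (retInt_arg_smooth hH) (volume.restrict (Set.Icc (0 : ℝ) 1))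
    (K := Set.Icc 0 1) isCompact_Icc (by rw [Measure.restrict_restrict measurableSet_Icc]; simp)]
  congr 1; ext s
  have h0 : HasFDerivAt (fun y : Spt => y 0) (ContinuousLinearMap.proj (R := ℝ) (φ := fun _ => ℝ)
    (0 : Fin 4)) x := hasFDerivAt_apply (0 : Fin 4) x
  have h1 := (h0.mul_const s).prodMk
    ((hasFDerivAt_id x).sub ((h0.const_mul s).smul_const (ev 0)))
  have h2 := (smooth_diff hH (x 0 * s, x - (s * x 0) • ev 0)).hasFDerivAt.comp x h1
  have h3 := h0.mul h2
  have h4 := h3.fderiv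
  simp only [Function.comp_def] at h4
  refine (congrArg (fun L => L v) h4).trans ?_
  simp [mul_comm s]
  ring

lemma retInt_space {H : ℝ × Spt → ℝ} (hH : ContDiff ℝ (⊤ : ℕ∞) H) {i : Fin 4} (hi : i ≠ 0) :
    pd i (retInt H) = retInt (fun p => fderiv ℝ H p (0, ev i)) := by
  funext x
  unfold pd
  rw [retInt_deriv hH]
  unfold retInt
  congr 1; ext s
  simp [hi.symm, ev]

lemma retInt_time {H : ℝ × Spt → ℝ} (hH : ContDiff ℝ (⊤ : ℕ∞) H) :
    pd 0 (retInt H) = fun x => H (0, x) + retInt (fun p => fderiv ℝ H p (1, 0)) x := by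
  funext x
  unfold pd
  rw [retInt_deriv hH]
  unfold retInt
  have hH' := smooth_fderiv_apply hH (1, 0)
  have hγ : ∀ s : ℝ, HasDerivAt (fun s : ℝ => ((x 0 * s, x - (s * x 0) • ev 0) : ℝ × Spt))
      (x 0, - x 0 • ev 0) s := by
    intro s
    have h1 : HasDerivAt (fun s : ℝ => x 0 * s) (x 0) s := by
      simpa using (hasDerivAt_id s).const_mul (x 0)
    have h2 : HasDerivAt (fun s : ℝ => s * x 0) (x 0) s := by
      simpa using (hasDerivAt_id s).mul_const (x 0)
    have h3 := (h2.smul_const (ev 0)).const_sub x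
    rw [← neg_smul] at h3
    exact h1.prodMk h3
  have hγc : Continuous (fun s : ℝ => ((x 0 * s, x - (s * x 0) • ev 0) : ℝ × Spt)) := by
    fun_prop
  have hder : ∀ s : ℝ, HasDerivAt (fun s : ℝ => (s - 1) * H (x 0 * s, x - (s * x 0) • ev 0))
      (H (x 0 * s, x - (s * x 0) • ev 0) + (s - 1) *
        fderiv ℝ H (x 0 * s, x - (s * x 0) • ev 0) (x 0, - x 0 • ev 0)) s := by
    intro s
    have h1 := (smooth_diff hH (x 0 * s, x - (s * x 0) • ev 0)).hasFDerivAt.comp_hasDerivAt s (hγ s)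
    have h2 := ((hasDerivAt_id s).sub_const 1).mul h1
    refine (h2.congr_deriv ?_)
    simp
  have hsplit : ∀ s : ℝ, fderiv ℝ H (x 0 * s, x - (s * x 0) • ev 0) (x 0, - x 0 • ev 0)
      = x 0 * (fderiv ℝ H (x 0 * s, x - (s * x 0) • ev 0) (1, 0)
        - fderiv ℝ H (x 0 * s, x - (s * x 0) • ev 0) (0, ev 0)) := by
    intro s
    have : ((x 0, - x 0 • ev 0) : ℝ × Spt) = x 0 • ((1, 0) - (0, ev 0)) := by
      ext <;> simp
    rw [this, map_smul, map_sub, smul_eq_mul]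
  have hsplit2 : ∀ s : ℝ, fderiv ℝ H (x 0 * s, x - (s * x 0) • ev 0) (s, (1 - s) • ev 0)
      = s * fderiv ℝ H (x 0 * s, x - (s * x 0) • ev 0) (1, 0)
        + (1 - s) * fderiv ℝ H (x 0 * s, x - (s * x 0) • ev 0) (0, ev 0) := by
    intro s
    have : ((s, (1 - s) • ev 0) : ℝ × Spt) = s • (1, 0) + (1 - s) • (0, ev 0) := by
      ext <;> simp
    rw [this, map_add, map_smul, map_smul, smul_eq_mul, smul_eq_mul]
  have hcF : Continuous (fun s : ℝ =>
      fderiv ℝ H (x 0 * s, x - (s * x 0) • ev 0) (x 0, - x 0 • ev 0)) :=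
    (smooth_fderiv_apply hH (x 0, - x 0 • ev 0)).continuous.comp hγc
  have hcH : Continuous (fun s : ℝ => H (x 0 * s, x - (s * x 0) • ev 0)) :=
    hH.continuous.comp hγc
  have hcR : Continuous (fun s : ℝ => fderiv ℝ H (x 0 * s, x - (s * x 0) • ev 0) (1, 0)) :=
    hH'.continuous.comp hγc
  have hcD : Continuous (fun s : ℝ => H (x 0 * s, x - (s * x 0) • ev 0) + (s - 1) *
        fderiv ℝ H (x 0 * s, x - (s * x 0) • ev 0) (x 0, - x 0 • ev 0)) := by fun_prop
  have hftc := intervalIntegral.integral_eq_sub_of_hasDerivAt (a := 0) (b := 1)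
    (fun s _ => hder s) (hcD.intervalIntegrable _ _)
  rw [intervalIntegral.integral_of_le zero_le_one, ← integral_Icc_eq_integral_Ioc] at hftc
  have hend : (1 - 1) * H (x 0 * 1, x - ((1 : ℝ) * x 0) • ev 0)
      - (0 - 1) * H (x 0 * 0, x - ((0 : ℝ) * x 0) • ev 0) = H (0, x) := by simp
  rw [hend] at hftc
  rw [← hftc]
  refine Eq.trans ?_ (integral_add (hcD.continuousOn.integrableOn_compact isCompact_Icc)
    ((hcR.const_mul (x 0)).continuousOn.integrableOn_compact isCompact_Icc))
  congr 1; ext s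
  have e1 : (Pi.single (0 : Fin 4) (1 : ℝ) : Spt) 0 = 1 := by simp
  have e2 : ((1 * s, Pi.single (0 : Fin 4) (1 : ℝ) - (s * 1) • ev 0) : ℝ × Spt)
      = (s, (1 - s) • ev 0) := by
    rw [sub_smul]; simp [ev]
  rw [e1, e2, hsplit, hsplit2]
  ring

/-! ### Spherical means -/

/-- `r` times the spherical mean of `f`. -/
def sphMean (μ : Measure Spt) (f : Spt → ℝ) (p : ℝ × Spt) : ℝ :=
  ∫ ω, p.1 * f (p.2 + p.1 • ω) ∂μ

lemma comp_deriv {f : Spt → ℝ} (hf : ContDiff ℝ (⊤ : ℕ∞) f) (ω : Spt) (p : ℝ × Spt) :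
    HasFDerivAt (fun q : ℝ × Spt => f (q.2 + q.1 • ω))
      ((fderiv ℝ f (p.2 + p.1 • ω)).comp (ContinuousLinearMap.snd ℝ ℝ Spt +
        (ContinuousLinearMap.fst ℝ ℝ Spt).smulRight ω)) p := by
  have h1 : HasFDerivAt (fun q : ℝ × Spt => q.2 + q.1 • ω) (ContinuousLinearMap.snd ℝ ℝ Spt +
        (ContinuousLinearMap.fst ℝ ℝ Spt).smulRight ω) p :=
    hasFDerivAt_snd.add (hasFDerivAt_fst.smul_const ω)
  exact (smooth_diff hf _).hasFDerivAt.comp p h1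

lemma arg_smooth {f : Spt → ℝ} (hf : ContDiff ℝ (⊤ : ℕ∞) f) :
    ContDiff ℝ (⊤ : ℕ∞) (fun z : (ℝ × Spt) × Spt => f (z.1.2 + z.1.1 • z.2)) := by
  have : ContDiff ℝ (⊤ : ℕ∞) (fun z : (ℝ × Spt) × Spt => z.1.2 + z.1.1 • z.2) := by fun_prop
  exact hf.comp this

lemma sphMean_arg_smooth {f : Spt → ℝ} (hf : ContDiff ℝ (⊤ : ℕ∞) f) :
    ContDiff ℝ (⊤ : ℕ∞) (Function.uncurry fun (p : ℝ × Spt) (ω : Spt) =>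
      p.1 * f (p.2 + p.1 • ω)) := by
  have h1 : ContDiff ℝ (⊤ : ℕ∞) (fun z : (ℝ × Spt) × Spt => z.1.1) := by fun_prop
  exact h1.mul (arg_smooth hf)

lemma sphMean_smooth {μ : Measure Spt} [IsProbabilityMeasure μ]
    (hK : μ.restrict (Metric.closedBall 0 1) = μ)
    {f : Spt → ℝ} (hf : ContDiff ℝ (⊤ : ℕ∞) f) : ContDiff ℝ (⊤ : ℕ∞) (sphMean μ f) :=
  param_smooth (sphMean_arg_smooth hf) μ (isCompact_closedBall _ _) hK

lemma pd_smooth {f : Spt → ℝ} (hf : ContDiff ℝ (⊤ : ℕ∞) f) (i : Fin 4) :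
    ContDiff ℝ (⊤ : ℕ∞) (pd i f) := smooth_fderiv_apply hf _

lemma fderiv_eq_sum (f : Spt → ℝ) (y ω : Spt) : fderiv ℝ f y ω = ∑ i, ω i * pd i f y := by
  have : ω = ∑ i, ω i • (Pi.single i 1 : Spt) := by
    ext k; simp [Finset.sum_apply, Pi.single_apply]
  conv_lhs => rw [this]
  simp [map_sum, pd]

lemma sphMean_space {μ : Measure Spt} [IsProbabilityMeasure μ]
    (hK : μ.restrict (Metric.closedBall 0 1) = μ)
    {f : Spt → ℝ} (hf : ContDiff ℝ (⊤ : ℕ∞) f) (i : Fin 4) :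
    (fun p => fderiv ℝ (sphMean μ f) p (0, ev i)) = sphMean μ (pd i f) := by
  funext p
  unfold sphMean
  rw [param_fderiv (sphMean_arg_smooth hf) μ (isCompact_closedBall _ _) hK]
  congr 1; ext ω
  refine (congrArg (fun L => L (0, ev i))
    ((hasFDerivAt_fst (𝕜 := ℝ) (p := p)).mul (comp_deriv hf ω p)).fderiv).trans ?_
  simp [pd, ev]

lemma sphMean_rad {μ : Measure Spt} [IsProbabilityMeasure μ]
    (hK : μ.restrict (Metric.closedBall 0 1) = μ)
    {f : Spt → ℝ} (hf : ContDiff ℝ (⊤ : ℕ∞) f) :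
    (fun p => fderiv ℝ (sphMean μ f) p (1, 0)) = fun p : ℝ × Spt =>
      ∫ ω, (f (p.2 + p.1 • ω) + p.1 * ∑ i, ω i * pd i f (p.2 + p.1 • ω)) ∂μ := by
  funext p
  unfold sphMean
  rw [param_fderiv (sphMean_arg_smooth hf) μ (isCompact_closedBall _ _) hK]
  congr 1; ext ω
  refine (congrArg (fun L => L (1, 0))
    ((hasFDerivAt_fst (𝕜 := ℝ) (p := p)).mul (comp_deriv hf ω p)).fderiv).trans ?_
  simp [fderiv_eq_sum]
  ring

lemma sphMean_rad_rad {μ : Measure Spt} [IsProbabilityMeasure μ]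
    (hK : μ.restrict (Metric.closedBall 0 1) = μ)
    {f : Spt → ℝ} (hf : ContDiff ℝ (⊤ : ℕ∞) f) (p : ℝ × Spt) :
    fderiv ℝ (fun p => fderiv ℝ (sphMean μ f) p (1, 0)) p (1, 0) =
      ∫ ω, (2 * (∑ i, ω i * pd i f (p.2 + p.1 • ω))
        + p.1 * ∑ i, ω i * ∑ j, ω j * pd j (pd i f) (p.2 + p.1 • ω)) ∂μ := by
  rw [sphMean_rad hK hf]
  have hs : ContDiff ℝ (⊤ : ℕ∞) (Function.uncurry fun (p : ℝ × Spt) (ω : Spt) =>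
      f (p.2 + p.1 • ω) + p.1 * ∑ i, ω i * pd i f (p.2 + p.1 • ω)) := by
    have h1 : ContDiff ℝ (⊤ : ℕ∞) (fun z : (ℝ × Spt) × Spt => z.1.1) := by fun_prop
    have h2 : ∀ i, ContDiff ℝ (⊤ : ℕ∞) (fun z : (ℝ × Spt) × Spt => z.2 i) := by
      intro i; fun_prop
    exact (arg_smooth hf).add (h1.mul (ContDiff.sum fun i _ =>
      (h2 i).mul (arg_smooth (pd_smooth hf i))))
  rw [param_fderiv hs μ (isCompact_closedBall _ _) hK]
  congr 1; ext ω
  have h3 := (comp_deriv hf ω p).add ((hasFDerivAt_fst (𝕜 := ℝ) (p := p)).mul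
    (HasFDerivAt.fun_sum (u := Finset.univ) fun i _ =>
      (comp_deriv (pd_smooth hf i) ω p).const_mul (ω i)))
  refine (congrArg (fun L => L (1, 0)) h3.fderiv).trans ?_
  simp [fderiv_eq_sum]
  ring

lemma rot_identity {μ : Measure Spt} [IsProbabilityMeasure μ]
    (hK : μ.restrict (Metric.closedBall 0 1) = μ) {i j : Fin 4} (hij : i ≠ j)
    (hinv : ∀ θ, μ.map (rot i j θ) = μ) {f : Spt → ℝ} (hf : ContDiff ℝ (⊤ : ℕ∞) f)
    (p : ℝ × Spt) :
    ∫ ω, (- ω j * pd j f (p.2 + p.1 • ω) - ω i * pd i f (p.2 + p.1 • ω)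
      + p.1 * (ω i ^ 2 * pd j (pd j f) (p.2 + p.1 • ω)
        - ω i * ω j * (pd i (pd j f) (p.2 + p.1 • ω) + pd j (pd i f) (p.2 + p.1 • ω))
        + ω j ^ 2 * pd i (pd i f) (p.2 + p.1 • ω))) ∂μ = 0 := by
  have hg : ∀ g : Spt → ℝ, ContDiff ℝ (⊤ : ℕ∞) g →
      ContDiff ℝ (⊤ : ℕ∞) (fun ω : Spt => g (p.2 + p.1 • ω)) := by
    intro g hg
    have : ContDiff ℝ (⊤ : ℕ∞) (fun ω : Spt => p.2 + p.1 • ω) := by fun_prop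
    exact hg.comp this
  have hh : ContDiff ℝ (⊤ : ℕ∞) (fun ω : Spt =>
      ω i * pd j f (p.2 + p.1 • ω) - ω j * pd i f (p.2 + p.1 • ω)) := by
    have h2 : ∀ i, ContDiff ℝ (⊤ : ℕ∞) (fun z : Spt => z i) := by
      intro i; fun_prop
    exact ((h2 i).mul (hg _ (pd_smooth hf j))).sub ((h2 j).mul (hg _ (pd_smooth hf i)))
  rw [← rot_integral hK hinv hh]
  congr 1; ext ω
  have hc : ∀ g : Spt → ℝ, ContDiff ℝ (⊤ : ℕ∞) g →
      HasFDerivAt (fun ω : Spt => g (p.2 + p.1 • ω))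
        ((fderiv ℝ g (p.2 + p.1 • ω)).comp (p.1 • ContinuousLinearMap.id ℝ Spt)) ω := by
    intro g hg
    exact (smooth_diff hg _).hasFDerivAt.comp ω (((hasFDerivAt_id ω).const_smul p.1).const_add p.2)
  have hp : ∀ k : Fin 4, HasFDerivAt (fun y : Spt => y k)
      (ContinuousLinearMap.proj (R := ℝ) (φ := fun _ => ℝ) k) ω := fun k => hasFDerivAt_apply k ω
  have h3 := ((hp i).mul (hc _ (pd_smooth hf j))).sub ((hp j).mul (hc _ (pd_smooth hf i)))
  refine Eq.symm ((congrArg (fun L => L (ω i • ev j - ω j • ev i)) h3.fderiv).trans ?_)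
  have e1 : ∀ (g : Spt → ℝ) (y : Spt) k, fderiv ℝ g y (ev k) = pd k g y := fun _ _ _ => rfl
  have e2 : ev j i = 0 := by simp [ev, hij]
  have e3 : ev i j = 0 := by simp [ev, hij.symm]
  have e4 : ∀ k, ev k k = 1 := by simp [ev]
  simp [e1, e2, e3, e4]
  ring

lemma darboux {μ : Measure Spt} [IsProbabilityMeasure μ]
    (hK : μ.restrict (Metric.closedBall 0 1) = μ)
    (hae : ∀ᵐ ω ∂μ, ω 0 = 0 ∧ rad2 ω = 1)
    (hinv : ∀ i j, IsPlane i j → ∀ θ, μ.map (rot i j θ) = μ)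
    {f : Spt → ℝ} (hf : ContDiff ℝ (⊤ : ℕ∞) f) (p : ℝ × Spt) :
    fderiv ℝ (fun p => fderiv ℝ (sphMean μ f) p (1, 0)) p (1, 0) =
      sphMean μ (pd 1 (pd 1 f)) p + sphMean μ (pd 2 (pd 2 f)) p
        + sphMean μ (pd 3 (pd 3 f)) p := by
  rw [sphMean_rad_rad hK hf]
  have r12 := rot_identity hK (i := 1) (j := 2) (by decide) (hinv _ _ (by simp [IsPlane])) hf p
  have r13 := rot_identity hK (i := 1) (j := 3) (by decide) (hinv _ _ (by simp [IsPlane])) hf p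
  have r23 := rot_identity hK (i := 2) (j := 3) (by decide) (hinv _ _ (by simp [IsPlane])) hf p
  have hcont : ∀ g : Spt → ℝ, ContDiff ℝ (⊤ : ℕ∞) g →
      Continuous (fun ω : Spt => g (p.2 + p.1 • ω)) := fun g hg =>
    hg.continuous.comp (by fun_prop)
  have c1 : ∀ i, Continuous (fun ω : Spt => pd i f (p.2 + p.1 • ω)) :=
    fun i => hcont _ (pd_smooth hf i)
  have c2 : ∀ i j, Continuous (fun ω : Spt => pd i (pd j f) (p.2 + p.1 • ω)) :=
    fun i j => hcont _ (pd_smooth (pd_smooth hf j) i)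
  have hint : ∀ g : Spt → ℝ, Continuous g → Integrable g μ := fun g hg =>
    param_integrable hg μ (isCompact_closedBall _ _) hK
  unfold sphMean
  rw [← integral_add (hint _ (by fun_prop)) (hint _ (by fun_prop)),
    ← integral_add (hint _ (by fun_prop)) (hint _ (by fun_prop))]
  rw [← sub_eq_zero, ← integral_sub (hint _ (by fun_prop)) (hint _ (by fun_prop))]
  have hsum := congrArg₂ (· + ·) (congrArg₂ (· + ·) r12 r13) r23
  simp only [add_zero] at hsum
  rw [← integral_add (hint _ (by fun_prop)) (hint _ (by fun_prop)),
    ← integral_add (hint _ (by fun_prop)) (hint _ (by fun_prop))] at hsum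
  rw [← neg_eq_zero, ← hsum, ← integral_neg]
  refine integral_congr_ae (hae.mono fun ω hω => ?_)
  obtain ⟨h0, h1⟩ := hω
  unfold rad2 at h1
  simp only [Fin.sum_univ_four, h0]
  linear_combination (- p.1 * (pd 1 (pd 1 f) (p.2 + p.1 • ω) + pd 2 (pd 2 f) (p.2 + p.1 • ω)
    + pd 3 (pd 3 f) (p.2 + p.1 • ω))) * h1

/-- The wave operator has a smooth right inverse. -/
lemma wave_solve {f : Spt → ℝ} (hf : ContDiff ℝ (⊤ : ℕ∞) f) :
    ∃ u : Spt → ℝ, ContDiff ℝ (⊤ : ℕ∞) u ∧ ∀ x,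
      f x = - pd 0 (pd 0 u) x + pd 1 (pd 1 u) x + pd 2 (pd 2 u) x + pd 3 (pd 3 u) x := by
  obtain ⟨μ, hprob, hK, hae, hinv⟩ := exists_sphere_measure
  set g : Spt → ℝ := fun x => - f x with hgdef
  have hg : ContDiff ℝ (⊤ : ℕ∞) g := hf.neg
  have hS := sphMean_smooth hK hg
  have hSr := smooth_fderiv_apply hS (1, 0)
  refine ⟨retInt (sphMean μ g), retInt_smooth hS, fun x => ?_⟩
  have hsp : ∀ i, i ≠ 0 → pd i (pd i (retInt (sphMean μ g)))
      = retInt (sphMean μ (pd i (pd i g))) := by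
    intro i hi
    rw [retInt_space hS hi, sphMean_space hK hg,
      retInt_space (sphMean_smooth hK (pd_smooth hg i)) hi, sphMean_space hK (pd_smooth hg i)]
  have h0 : pd 0 (retInt (sphMean μ g)) =
      retInt (fun p => fderiv ℝ (sphMean μ g) p (1, 0)) := by
    rw [retInt_time hS]
    funext y
    simp [sphMean]
  have h00 : pd 0 (pd 0 (retInt (sphMean μ g))) x = g x +
      (retInt (sphMean μ (pd 1 (pd 1 g))) x + retInt (sphMean μ (pd 2 (pd 2 g))) x
        + retInt (sphMean μ (pd 3 (pd 3 g))) x) := by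
    rw [h0, retInt_time hSr]
    have e1 : fderiv ℝ (sphMean μ g) (0, x) (1, 0) = g x := by
      have := congrFun (sphMean_rad hK hg) (0, x)
      simpa using this
    simp only [e1]
    congr 1
    have hc : ∀ i, Continuous fun s : ℝ =>
        x 0 * sphMean μ (pd i (pd i g)) (x 0 * s, x - (s * x 0) • ev 0) := fun i =>
      continuous_const.mul ((sphMean_smooth hK (pd_smooth (pd_smooth hg i) i)).continuous.comp
        (by fun_prop))
    have hi : ∀ i, IntegrableOn (fun s : ℝ =>
        x 0 * sphMean μ (pd i (pd i g)) (x 0 * s, x - (s * x 0) • ev 0)) (Set.Icc 0 1) volume :=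
      fun i => (hc i).continuousOn.integrableOn_compact isCompact_Icc
    unfold retInt
    rw [← integral_add (hi 1) (hi 2)]
    refine Eq.trans ?_ (integral_add ((hi 1).add (hi 2)) (hi 3))
    congr 1; ext s
    simp only
    rw [darboux hK hae hinv hg]
    ring
  rw [h00, hsp 1 (by decide), hsp 2 (by decide), hsp 3 (by decide)]
  simp only [hgdef]
  ring

/-! ### Tensor algebra -/

/-- Diagonal entries of the metric. -/
def sg (a : Fin 4) : ℝ := if a = 0 then -1 else 1

lemma sg_sq (a : Fin 4) : sg a * sg a = 1 := by unfold sg; split_ifs <;> norm_num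

lemma raise2_eq (Y : Fin 4 → Fin 4 → ℝ) (a b : Fin 4) : raise2 Y a b = sg a * sg b * Y a b := by
  simp [raise2, mink, sg]

/-- Explicit components of the Hodge dual. -/
def hx (Y : Fin 4 → Fin 4 → ℝ) : Fin 4 → Fin 4 → ℝ :=
  ![![0, Y 2 3, - Y 1 3, Y 1 2], ![- Y 2 3, 0, - Y 0 3, Y 0 2],
    ![Y 1 3, Y 0 3, 0, - Y 0 1], ![- Y 1 2, - Y 0 2, Y 0 1, 0]]

lemma hodge_eq_hx {Y : Fin 4 → Fin 4 → ℝ} (hY : ∀ a b, Y a b = - Y b a) : hodge Y = hx Y := by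
  funext a b
  unfold hodge
  simp only [raise2_eq, Fin.sum_univ_four]
  have h10 := hY 1 0
  have h20 := hY 2 0
  have h30 := hY 3 0
  have h21 := hY 2 1
  have h31 := hY 3 1
  have h32 := hY 3 2
  fin_cases a <;> fin_cases b <;> simp [lev, sg, hx] <;> linarith

lemma hx_anti (Y : Fin 4 → Fin 4 → ℝ) (a b : Fin 4) : hx Y a b = - hx Y b a := by
  fin_cases a <;> fin_cases b <;> simp [hx]

lemma anti_diag {Y : Fin 4 → Fin 4 → ℝ} (hY : ∀ a b, Y a b = - Y b a) (a : Fin 4) :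
    Y a a = 0 := by linarith [hY a a]

lemma hx_hx {Y : Fin 4 → Fin 4 → ℝ} (hY : ∀ a b, Y a b = - Y b a) (a b : Fin 4) :
    hx (hx Y) a b = - Y a b := by
  have h10 := hY 1 0
  have h20 := hY 2 0
  have h30 := hY 3 0
  have h21 := hY 2 1
  have h31 := hY 3 1
  have h32 := hY 3 2
  fin_cases a <;> fin_cases b <;> simp [hx, anti_diag hY] <;> linarith

/-- Vanishing divergence means that the dual is closed. -/
lemma closed_of_div {D : Fin 4 → Fin 4 → Fin 4 → ℝ} (hD : ∀ e a b, D e a b = - D e b a)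
    (hdiv : ∀ a, ∑ b, sg b * D b a b = 0) (a b c : Fin 4) :
    hx (D a) b c + hx (D b) c a + hx (D c) a b = 0 := by
  have d0 := hdiv 0
  have d1 := hdiv 1
  have d2 := hdiv 2
  have d3 := hdiv 3
  simp only [Fin.sum_univ_four, anti_diag (hD _), hD _ 1 0, hD _ 2 0, hD _ 3 0, hD _ 2 1, hD _ 3 1,
    hD _ 3 2] at d0 d1 d2 d3
  simp [sg] at d0 d1 d2 d3
  fin_cases a <;> fin_cases b <;> fin_cases c <;> simp [hx] <;> linarith

/-- A closed field has dual of vanishing divergence. -/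
lemma div_of_closed {D : Fin 4 → Fin 4 → Fin 4 → ℝ} (hD : ∀ e a b, D e a b = - D e b a)
    (hc : ∀ a b c, D a b c + D b c a + D c a b = 0) (a : Fin 4) :
    ∑ b, sg b * hx (D b) a b = 0 := by
  have d0 := hc 0 1 2
  have d1 := hc 0 1 3
  have d2 := hc 0 2 3
  have d3 := hc 1 2 3
  simp only [hD _ 2 0, hD _ 3 0, hD _ 3 1] at d0 d1 d2 d3
  rw [Fin.sum_univ_four]
  fin_cases a <;> simp [hx, sg] <;> linarith

/-! ### Derivatives of tensor fields -/

lemma pd_comb {g : Fin 4 → Spt → ℝ} (hg : ∀ c, ContDiff ℝ (⊤ : ℕ∞) (g c)) (k : Fin 4 → ℝ)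
    (a : Fin 4) : pd a (fun y => ∑ c, k c * g c y) = fun x => ∑ c, k c * pd a (g c) x := by
  funext x
  have h := HasFDerivAt.fun_sum (u := Finset.univ) fun c _ =>
    ((smooth_diff (hg c) x).hasFDerivAt.const_mul (k c))
  unfold pd
  rw [h.fderiv]
  simp

lemma pd_sub {f g : Spt → ℝ} (hf : ContDiff ℝ (⊤ : ℕ∞) f) (hg : ContDiff ℝ (⊤ : ℕ∞) g)
    (a : Fin 4) : pd a (fun y => f y - g y) = fun x => pd a f x - pd a g x := by
  funext x
  unfold pd
  rw [fderiv_fun_sub (smooth_diff hf x) (smooth_diff hg x)]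
  simp

lemma pd_smul (c : ℝ) {f : Spt → ℝ} (hf : ContDiff ℝ (⊤ : ℕ∞) f) (a : Fin 4) :
    pd a (fun y => c * f y) = fun x => c * pd a f x := by
  funext x
  unfold pd
  rw [fderiv_const_mul (smooth_diff hf x)]
  simp

lemma pd_neg (f : Spt → ℝ) (a : Fin 4) : pd a (fun y => - f y) = fun x => - pd a f x := by
  funext x
  unfold pd
  rw [fderiv_fun_neg]
  simp

lemma pd_comm {f : Spt → ℝ} (hf : ContDiff ℝ (⊤ : ℕ∞) f) (a b : Fin 4) :
    pd a (pd b f) = pd b (pd a f) := by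
  funext x
  have hd : DifferentiableAt ℝ (fderiv ℝ f) x :=
    (hf.fderiv_right (m := (⊤ : ℕ∞)) (by simp)).differentiable (by simp) x
  have hsym : IsSymmSndFDerivAt ℝ f x := (hf.contDiffAt).isSymmSndFDerivAt (by
    simp only [minSmoothness_of_isRCLikeNormedField]
    exact WithTop.coe_le_coe.2 (le_top : (2 : ℕ∞) ≤ ⊤))
  have h : ∀ v w : Spt, fderiv ℝ (fun y => fderiv ℝ f y v) x w
      = fderiv ℝ (fderiv ℝ f) x w v := by
    intro v w
    rw [fderiv_clm_apply hd (differentiableAt_const v)]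
    simp
  unfold pd
  rw [h, h]
  exact hsym _ _

lemma pd_hx {Y : Spt → Fin 4 → Fin 4 → ℝ} (e a b : Fin 4) (x : Spt) :
    pd e (fun y => hx (Y y) a b) x = hx (fun c d => pd e (fun y => Y y c d) x) a b := by
  have h0 : pd e (fun _ => (0 : ℝ)) x = 0 := by simp [pd]
  fin_cases a <;> fin_cases b <;> simp [hx, pd_neg, h0]

lemma alpha_eq {Y : Spt → Fin 4 → Fin 4 → ℝ} (hY : ∀ a b, ContDiff ℝ (⊤ : ℕ∞) (fun x => Y x a b))
    (a : Fin 4) (x : Spt) :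
    alphaCurrent Y a x = sg a * ∑ b, sg b * pd b (fun y => Y y a b) x := by
  unfold alphaCurrent
  simp only [raise2_eq]
  rw [Finset.mul_sum]
  refine Finset.sum_congr rfl fun b _ => ?_
  rw [pd_smul _ (hY a b)]
  ring

lemma sum_anti {S : Fin 4 → Fin 4 → ℝ} (h : ∀ b c, S b c = - S c b) :
    ∑ b, ∑ c, S b c = 0 := by
  have h1 : ∑ b, ∑ c, S b c = - ∑ b, ∑ c, S b c := by
    conv_lhs => rw [Finset.sum_comm]
    rw [← Finset.sum_neg_distrib]
    refine Finset.sum_congr rfl fun b _ => ?_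
    rw [← Finset.sum_neg_distrib]
    exact Finset.sum_congr rfl fun c _ => h c b
  linarith

/-- Split theorem: any smooth field of antisymmetric matrices decomposes as
`X = X_α - *(X_β)` with `X_α, X_β` smooth, antisymmetric and closed, where
`X_α` carries the α-current of `X` and `X_β` carries the β-current of `X`. -/
theorem split_theorem
    (X : (Fin 4 → ℝ) → Fin 4 → Fin 4 → ℝ)
    (hanti : ∀ x a b, X x a b = - X x b a)
    (hsmooth : ∀ a b, ContDiff ℝ (⊤ : ℕ∞) (fun x => X x a b)) :
    ∃ Xa Xb : (Fin 4 → ℝ) → Fin 4 → Fin 4 → ℝ,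
      (∀ a b, ContDiff ℝ (⊤ : ℕ∞) (fun x => Xa x a b)) ∧
      (∀ a b, ContDiff ℝ (⊤ : ℕ∞) (fun x => Xb x a b)) ∧
      (∀ x a b, Xa x a b = - Xa x b a) ∧
      (∀ x a b, Xb x a b = - Xb x b a) ∧
      (∀ (x : Fin 4 → ℝ) (a b c : Fin 4),
        pd a (fun y => Xa y b c) x + pd b (fun y => Xa y c a) x
          + pd c (fun y => Xa y a b) x = 0) ∧
      (∀ (x : Fin 4 → ℝ) (a b c : Fin 4),
        pd a (fun y => Xb y b c) x + pd b (fun y => Xb y c a) x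
          + pd c (fun y => Xb y a b) x = 0) ∧
      (∀ (x : Fin 4 → ℝ) (a b : Fin 4), X x a b = Xa x a b - hodge (Xb x) a b) ∧
      (∀ (x : Fin 4 → ℝ) (a : Fin 4), alphaCurrent Xa a x = alphaCurrent X a x) ∧
      (∀ (x : Fin 4 → ℝ) (a : Fin 4), alphaCurrent Xb a x = betaCurrent X a x) := by
  classical
  -- potentials
  choose V hVs hV using fun a b => wave_solve (hsmooth a b)
  let W : Fin 4 → Fin 4 → Spt → ℝ := fun a b y => (1 / 2) * (V a b y - V b a y)
  have hWs : ∀ a b, ContDiff ℝ (⊤ : ℕ∞) (W a b) := fun a b =>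
    contDiff_const.mul ((hVs a b).sub (hVs b a))
  have hWa : ∀ a b, W a b = fun y => - W b a y := by
    intro a b; funext y; simp only [W]; ring
  have hpdW : ∀ e a b, pd e (pd e (W a b)) = fun x =>
      (1 / 2) * (pd e (pd e (V a b)) x - pd e (pd e (V b a)) x) := by
    intro e a b
    have h1 : pd e (W a b) = fun x => (1 / 2) * (pd e (V a b) x - pd e (V b a) x) := by
      simp only [W]
      rw [pd_smul _ ((hVs a b).sub (hVs b a)), pd_sub (hVs a b) (hVs b a)]
    rw [h1, pd_smul _ ((pd_smooth (hVs a b) e).sub (pd_smooth (hVs b a) e)),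
      pd_sub (pd_smooth (hVs a b) e) (pd_smooth (hVs b a) e)]
  have hbox : ∀ a b, (fun x => X x a b) = fun x => ∑ e, sg e * pd e (pd e (W a b)) x := by
    intro a b
    funext x
    simp only [hpdW, Fin.sum_univ_four]
    simp [sg]
    have h1 := hV a b x
    have h2 := hV b a x
    have h3 := hanti x a b
    linarith
  let A : Fin 4 → Spt → ℝ := fun b y => ∑ c, sg c * pd c (W c b) y
  have hAs : ∀ b, ContDiff ℝ (⊤ : ℕ∞) (A b) := fun b =>
    ContDiff.sum fun c _ => contDiff_const.mul (pd_smooth (hWs c b) c)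
  have hpA : ∀ a b, pd a (A b) = fun x => ∑ c, sg c * pd a (pd c (W c b)) x := fun a b =>
    pd_comb (fun c => pd_smooth (hWs c b) c) sg a
  let Xa : Spt → Fin 4 → Fin 4 → ℝ := fun y a b => pd a (A b) y - pd b (A a) y
  have hXas : ∀ a b, ContDiff ℝ (⊤ : ℕ∞) (fun x => Xa x a b) := fun a b =>
    (pd_smooth (hAs b) a).sub (pd_smooth (hAs a) b)
  have hXaa : ∀ x a b, Xa x a b = - Xa x b a := by
    intro x a b; simp only [Xa]; ring
  have hDXa : ∀ e a b, pd e (fun y => Xa y a b) =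
      fun x => pd e (pd a (A b)) x - pd e (pd b (A a)) x := fun e a b =>
    pd_sub (pd_smooth (hAs b) a) (pd_smooth (hAs a) b) e
  have hXac : ∀ (x : Fin 4 → ℝ) (a b c : Fin 4),
        pd a (fun y => Xa y b c) x + pd b (fun y => Xa y c a) x
          + pd c (fun y => Xa y a b) x = 0 := by
    intro x a b c
    simp only [hDXa]
    rw [pd_comm (hAs c) a b, pd_comm (hAs b) a c, pd_comm (hAs a) b c]
    ring
  -- Lorenz gauge
  have hgauge : (fun y => ∑ b, sg b * pd b (A b) y) = fun _ => 0 := by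
    funext y
    simp only [hpA, Finset.mul_sum]
    refine sum_anti fun b c => ?_
    rw [hWa c b, pd_neg, pd_neg, pd_comm (hWs b c) b c]
    ring
  have hdiv : ∀ x a, ∑ b, sg b * pd b (fun y => Xa y a b) x
      = ∑ b, sg b * pd b (fun y => X y a b) x := by
    intro x a
    have h1 : ∑ b, sg b * pd b (pd a (A b)) x = 0 := by
      have := congrFun (pd_comb (fun b => pd_smooth (hAs b) b) sg a) x
      rw [hgauge] at this
      have h0 : pd a (fun _ => (0 : ℝ)) x = 0 := by simp [pd]
      rw [h0] at this
      rw [this]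
      exact Finset.sum_congr rfl fun b _ => by rw [pd_comm (hAs b) a b]
    have h2 : ∀ b, pd b (pd b (A a)) x = ∑ c, sg c * pd b (pd b (pd c (W c a))) x := by
      intro b
      rw [hpA, pd_comb (fun c => pd_smooth (pd_smooth (hWs c a) c) b) sg b]
    have h3 : ∀ b, pd b (fun y => X y a b) x
        = ∑ e, sg e * pd b (pd e (pd e (W a b))) x := by
      intro b
      rw [hbox a b, pd_comb (fun e => pd_smooth (pd_smooth (hWs a b) e) e) sg b]
    simp only [hDXa, mul_sub, Finset.sum_sub_distrib, h1, h2, h3, Finset.mul_sum]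
    rw [zero_sub, Finset.sum_comm, ← Finset.sum_neg_distrib]
    refine Finset.sum_congr rfl fun b _ => ?_
    rw [← Finset.sum_neg_distrib]
    refine Finset.sum_congr rfl fun e _ => ?_
    have h4 : pd b (pd e (pd e (W a b))) x = - pd e (pd e (pd b (W b a))) x := by
      rw [hWa a b, pd_neg, pd_neg, pd_neg, pd_comm (pd_smooth (hWs b a) e) b e,
        pd_comm (hWs b a) b e]
    rw [h4]
    ring
  -- the remainder
  let T : Spt → Fin 4 → Fin 4 → ℝ := fun y a b => X y a b - Xa y a b
  have hTs : ∀ a b, ContDiff ℝ (⊤ : ℕ∞) (fun x => T x a b) := fun a b =>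
    (hsmooth a b).sub (hXas a b)
  have hTa : ∀ x a b, T x a b = - T x b a := by
    intro x a b; simp only [T]; rw [hanti x a b, hXaa x a b]; ring
  have hDT : ∀ e a b, pd e (fun y => T y a b) =
      fun x => pd e (fun y => X y a b) x - pd e (fun y => Xa y a b) x := fun e a b =>
    pd_sub (hsmooth a b) (hXas a b) e
  have hDanti : ∀ Y : Spt → Fin 4 → Fin 4 → ℝ, (∀ x a b, Y x a b = - Y x b a) →
      ∀ x e a b, pd e (fun y => Y y a b) x = - pd e (fun y => Y y b a) x := by
    intro Y hY x e a b
    have : (fun y => Y y a b) = fun y => - Y y b a := funext fun y => hY y a b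
    rw [this, pd_neg]
  have hhx : ∀ Y : Spt → Fin 4 → Fin 4 → ℝ,
      (∀ a b, ContDiff ℝ (⊤ : ℕ∞) (fun x => Y x a b)) →
      ∀ a b, ContDiff ℝ (⊤ : ℕ∞) (fun x => hx (Y x) a b) := by
    intro Y hY a b
    fin_cases a <;> fin_cases b <;> simp [hx] <;>
      first | exact contDiff_const | exact hY _ _ | exact (hY _ _).neg
  refine ⟨Xa, fun y => hx (T y), hXas, hhx T hTs, hXaa, fun x a b => hx_anti _ a b, hXac,
    ?_, ?_, ?_, ?_⟩
  · intro x a b c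
    simp only [pd_hx]
    refine closed_of_div (D := fun e c d => pd e (fun y => T y c d) x) (hDanti T hTa x) ?_ a b c
    intro a
    simp only [hDT, mul_sub, Finset.sum_sub_distrib, hdiv, sub_self]
  · intro x a b
    rw [hodge_eq_hx (hx_anti _), hx_hx (hTa x)]
    simp only [T]
    ring
  · intro x a
    rw [alpha_eq hXas, alpha_eq hsmooth, hdiv]
  · intro x a
    have hb : betaCurrent X a x = alphaCurrent (fun y => hx (X y)) a x := by
      unfold betaCurrent alphaCurrent
      simp only [hodge_eq_hx (hanti _)]
    rw [hb, alpha_eq (hhx T hTs), alpha_eq (hhx X hsmooth)]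
    congr 1
    have hz := div_of_closed (D := fun e c d => pd e (fun y => Xa y c d) x) (hDanti Xa hXaa x)
      (hXac x) a
    have hl : ∀ b, hx (fun c d => pd b (fun y => T y c d) x) a b
        = hx (fun c d => pd b (fun y => X y c d) x) a b
          - hx (fun c d => pd b (fun y => Xa y c d) x) a b := by
      intro b
      simp only [hDT]
      fin_cases a <;> fin_cases b <;> simp [hx] <;> ring
    simp only [pd_hx, hl, mul_sub, Finset.sum_sub_distrib]
    rw [hz, sub_zero]
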